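/- arXiv:1706.09808 — 2 statements merged into one kernel-verified Lean document; each statement's English description precedes it below -/
import Mathlib

section
/- Let X be a finite-dimensional Euclidean space, h : X → ℝ a differentiable convex function, x_0 ∈ X, and (y_k) a sequence in X such that (∇h(y_k)) is bounded and h(x_0) − h(y_k) − ⟨∇h(y_k), x_0 − y_k⟩ → 0 as k → ∞. Then |∇h(x_0) − ∇h(y_k)| → 0. -/
open Filter Topology Set
open scoped RealInnerProductSpace

noncomputable section

/-- The first-order lower bound for a convex function differentiable at `y`. -/
theorem ConvexOn.add_inner_gradient_le {X : Type*} [NormedAddCommGroup X]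
    [InnerProductSpace ℝ X] [CompleteSpace X] {h : X → ℝ} (hconv : ConvexOn ℝ Set.univ h) {y : X}
    (hdiff : DifferentiableAt ℝ h y) (z : X) :
    h y + ⟪gradient h y, z - y⟫ ≤ h z := by
  have hline : ConvexOn ℝ Set.univ (fun t : ℝ => h (AffineMap.lineMap y z t)) :=
    hconv.comp_affineMap (AffineMap.lineMap y z : ℝ →ᵃ[ℝ] X)
  have hgrad : HasFDerivAt h (InnerProductSpace.toDual ℝ X (gradient h y))
      (AffineMap.lineMap y z (0 : ℝ)) := by
    simpa using hdiff.hasGradientAt.hasFDerivAt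
  have hderiv : HasDerivAt (fun t : ℝ => h (AffineMap.lineMap y z t))
      ⟪gradient h y, z - y⟫ 0 :=
    hgrad.comp_hasDerivAt (0 : ℝ) AffineMap.hasDerivAt_lineMap
  have hslope := hline.le_slope_of_hasDerivAt (mem_univ 0) (mem_univ 1) one_pos hderiv
  simp only [slope_def_field, AffineMap.lineMap_apply_zero, AffineMap.lineMap_apply_one, sub_zero,
    div_one] at hslope
  linarith

/-- **Lemma 3.1.** If `h : X → ℝ` is a differentiable convex function on a finite-dimensional
Euclidean space, `(y k)` is a sequence with `(∇h(y k))` bounded and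
`h(x₀) - h(y k) - ⟪∇h(y k), x₀ - y k⟫ → 0`, then `‖∇h(x₀) - ∇h(y k)‖ → 0`. -/
theorem gradient_convergence_of_bregman_tendsto_zero
    {X : Type*} [NormedAddCommGroup X] [InnerProductSpace ℝ X] [FiniteDimensional ℝ X]
    (h : X → ℝ) (hconv : ConvexOn ℝ Set.univ h) (hdiff : Differentiable ℝ h)
    (x₀ : X) (y : ℕ → X)
    (hbd : ∃ M, ∀ k, ‖gradient h (y k)‖ ≤ M)
    (hlim : Tendsto (fun k => h x₀ - h (y k) - ⟪gradient h (y k), x₀ - y k⟫) atTop (nhds 0)) :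
    Tendsto (fun k => ‖gradient h x₀ - gradient h (y k)‖) atTop (nhds 0) := by
  rw [Metric.tendsto_atTop]
  intro ε hε
  have hsmall := (hdiff x₀).hasGradientAt.hasFDerivAt.isLittleO.def (half_pos hε)
  obtain ⟨r, hr, hball⟩ := Metric.eventually_nhds_iff.1 hsmall
  obtain ⟨N, hN⟩ := Metric.tendsto_atTop.1 hlim (r / 2 * (ε / 2)) (by positivity)
  refine ⟨N, fun k hk => ?_⟩
  have hgap := hN k hk
  rw [Real.dist_eq, sub_zero] at hgap
  replace hgap := (abs_lt.1 hgap).2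
  rw [Real.dist_eq, sub_zero, abs_norm, norm_sub_rev]
  set v := gradient h (y k) - gradient h x₀
  rcases eq_or_ne v 0 with hv0 | hv0
  · simpa [hv0] using hε
  have hvpos : 0 < ‖v‖ := norm_pos_iff.2 hv0
  -- Test both first-order bounds at `x₀ + d`, with `d` of length `r / 2` in the direction `v`.
  set d : X := (r / 2 / ‖v‖) • v with hd
  have hdnorm : ‖d‖ = r / 2 := by
    rw [hd, norm_smul, Real.norm_of_nonneg (by positivity)]
    field_simp
  have hinner : ⟪v, d⟫ = r / 2 * ‖v‖ := by
    rw [hd, real_inner_smul_right, real_inner_self_eq_norm_sq]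
    field_simp
  have hupper := hball (y := x₀ + d) (by rw [dist_self_add_left, hdnorm]; linarith)
  simp only [add_sub_cancel_left, InnerProductSpace.toDual_apply_apply, hdnorm] at hupper
  replace hupper := (abs_le.1 hupper).2
  have hlower := hconv.add_inner_gradient_le (hdiff (y k)) (x₀ + d)
  rw [add_sub_right_comm, inner_add_right] at hlower
  have hsplit : ⟪v, d⟫ = ⟪gradient h (y k), d⟫ - ⟪gradient h x₀, d⟫ := inner_sub_left _ _ _
  have hprod : r / 2 * ‖v‖ < r / 2 * ε := by linarith
  exact lt_of_mul_lt_mul_left hprod (by positivity)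
end
end

section
/- Let X be a finite-dimensional Euclidean space, A a closed subset of X, and h : X → ℝ a convex and coercive function (h(x) → +∞ as |x| → ∞) that is differentiable at every point of A. Then there exists a convex and coercive function H : X → ℝ of class C¹ such that H(x) = h(x) and ∇H(x) = ∇h(x) for every x ∈ A. -/
open Filter Topology Set
open scoped RealInnerProductSpace

noncomputable section

open scoped Manifold

/-- A function squeezed between two functions that agree at `a` and have the same derivative there
has this derivative at `a`. -/
theorem HasFDerivAt.squeeze {X : Type*} [NormedAddCommGroup X] [NormedSpace ℝ X]
    {f g k : X → ℝ} {L : X →L[ℝ] ℝ} {a : X} (hf : HasFDerivAt f L a) (hk : HasFDerivAt k L a)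
    (hfg : ∀ x, f x ≤ g x) (hgk : ∀ x, g x ≤ k x) (hfa : f a = g a) (hka : k a = g a) :
    HasFDerivAt g L a := by
  rw [hasFDerivAt_iff_isLittleO, Asymptotics.isLittleO_iff] at *
  intro c hc
  filter_upwards [hf hc, hk hc] with x hx hx'
  rw [Real.norm_eq_abs, abs_le] at *
  constructor <;> linarith [hfg x, hgk x]

/-- A convex function touched from above by a differentiable function is differentiable. -/
theorem ConvexOn.hasFDerivAt_of_le {X : Type*} [NormedAddCommGroup X] [NormedSpace ℝ X]
    {f g : X → ℝ} {L : X →L[ℝ] ℝ} {a : X} (hf : ConvexOn ℝ univ f) (hg : HasFDerivAt g L a)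
    (hfg : ∀ x, f x ≤ g x) (ha : f a = g a) : HasFDerivAt f L a := by
  have hrefl : HasFDerivAt (fun x ↦ 2 * f a - g ((2 : ℝ) • a - x)) L a := by
    have h₁ : HasFDerivAt (fun x : X ↦ (2 : ℝ) • a - x) (-ContinuousLinearMap.id ℝ X) a :=
      (hasFDerivAt_id a).const_sub _
    have hg' : HasFDerivAt g L ((2 : ℝ) • a - a) := by
      rwa [two_smul, add_sub_cancel_right]
    have hL : -(L.comp (-ContinuousLinearMap.id ℝ X)) = L := by
      ext v
      simp
    exact hL ▸ (HasFDerivAt.comp a hg' h₁).const_sub (2 * f a)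
  refine hrefl.squeeze hg (fun x ↦ ?_) hfg ?_ ha.symm
  · have h₁ := hf.2 (mem_univ x) (mem_univ ((2 : ℝ) • a - x)) (by norm_num : (0 : ℝ) ≤ 1 / 2)
      (by norm_num : (0 : ℝ) ≤ 1 / 2) (by norm_num)
    have h₂ : (1 / 2 : ℝ) • x + (1 / 2 : ℝ) • ((2 : ℝ) • a - x) = a := by module
    rw [h₂] at h₁
    have := hfg ((2 : ℝ) • a - x)
    simp only [smul_eq_mul] at h₁
    linarith
  · have : (2 : ℝ) • a - a = a := by module
    simp only [this]
    linarith

/-- The derivative of a differentiable convex function is a subgradient. -/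
theorem ConvexOn.add_apply_sub_le_of_hasFDerivAt {X : Type*} [NormedAddCommGroup X] [NormedSpace ℝ X]
    {f : X → ℝ} {L : X →L[ℝ] ℝ} {a : X} (hf : ConvexOn ℝ univ f) (hL : HasFDerivAt f L a) (x : X) :
    f a + L (x - a) ≤ f x := by
  have hline : HasDerivAt (fun t : ℝ ↦ f (AffineMap.lineMap a x t)) (L (x - a)) 0 := by
    have h₁ : HasFDerivAt f L (AffineMap.lineMap a x (0 : ℝ)) := by simpa using hL
    exact h₁.comp_hasDerivAt (0 : ℝ) AffineMap.hasDerivAt_lineMap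
  have hconv : ConvexOn ℝ univ (fun t : ℝ ↦ f (AffineMap.lineMap a x t)) :=
    hf.comp_affineMap (AffineMap.lineMap a x : ℝ →ᵃ[ℝ] X)
  have := hconv.le_slope_of_hasDerivAt (mem_univ 0) (mem_univ 1) one_pos hline
  simp [slope_def_field] at this
  linarith [map_sub L x a]

/-- A differentiable convex function is continuously differentiable. -/
theorem ConvexOn.contDiff_one {X : Type*} [NormedAddCommGroup X] [NormedSpace ℝ X]
    {f : X → ℝ} (hf : ConvexOn ℝ univ f) (hd : Differentiable ℝ f) : ContDiff ℝ 1 f := by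
  refine contDiff_one_iff_fderiv.2 ⟨hd, continuous_iff_continuousAt.2 fun x ↦ ?_⟩
  rw [Metric.continuousAt_iff]
  intro ε hε
  have hx := (hd x).hasFDerivAt
  rw [hasFDerivAt_iff_isLittleO, Asymptotics.isLittleO_iff] at hx
  obtain ⟨r, hr, hball⟩ := Metric.eventually_nhds_iff.1 (hx (show 0 < ε / 4 by positivity))
  refine ⟨r / 2, by positivity, fun {y} hy ↦ ?_⟩
  rw [dist_eq_norm] at hy ⊢
  refine lt_of_le_of_lt ?_ (half_lt_self hε)
  have key : ∀ w : X, ‖w‖ = 1 → fderiv ℝ f y w - fderiv ℝ f x w ≤ ε / 2 := by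
    intro w hw
    have hv : ‖y + (r / 2) • w - x‖ < r := by
      calc ‖y + (r / 2) • w - x‖ = ‖(y - x) + (r / 2) • w‖ := by congr 1; abel
        _ ≤ ‖y - x‖ + ‖(r / 2) • w‖ := norm_add_le _ _
        _ < r := by
          rw [norm_smul, hw, Real.norm_of_nonneg (by positivity)]
          linarith
    have h₁ := hball (y := y + (r / 2) • w) (by rwa [dist_eq_norm])
    have h₂ := hf.add_apply_sub_le_of_hasFDerivAt (hd x).hasFDerivAt y
    have h₃ := hf.add_apply_sub_le_of_hasFDerivAt (hd y).hasFDerivAt (y + (r / 2) • w)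
    have h₄ : y + (r / 2) • w - x = (y - x) + (r / 2) • w := by abel
    have h₅ := (le_abs_self _).trans h₁
    have h₆ : ε / 4 * ‖y + (r / 2) • w - x‖ ≤ ε / 4 * r := by gcongr
    rw [h₄, map_add, map_smul, smul_eq_mul] at h₅
    rw [add_sub_cancel_left, map_smul, smul_eq_mul] at h₃
    rw [h₄] at h₆
    have h₇ : r * (fderiv ℝ f y w - fderiv ℝ f x w) ≤ r * (ε / 2) := by linarith
    exact le_of_mul_le_mul_left h₇ hr
  refine ContinuousLinearMap.opNorm_le_of_unit_norm (by positivity) fun w hw ↦ ?_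
  rw [Real.norm_eq_abs, abs_le, sub_apply]
  have h₁ := key (-w) (by rwa [norm_neg])
  simp only [map_neg] at h₁
  exact ⟨by linarith, key w hw⟩

/-- A continuous function on a finite-dimensional space can be approximated from above on an open
set by a differentiable function, with continuous positive precision. -/
theorem Continuous.exists_differentiableAt_le_le_add {X : Type*} [NormedAddCommGroup X]
    [NormedSpace ℝ X] [FiniteDimensional ℝ X] {f δ : X → ℝ} (hf : Continuous f)
    (hδ : Continuous δ) {U : Set X} (hU : IsOpen U) (hpos : ∀ x ∈ U, 0 < δ x) :
    ∃ u : X → ℝ, ∀ x ∈ U, DifferentiableAt ℝ u x ∧ f x ≤ u x ∧ u x ≤ f x + δ x := by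
  let V : TopologicalSpace.Opens X := ⟨U, hU⟩
  have : LocallyCompactSpace V := hU.locallyCompactSpace
  have : ProperSpace X := FiniteDimensional.proper ℝ X
  obtain ⟨g, hg, -⟩ := Continuous.exists_contMDiff_approx (M := V) (𝓘(ℝ, X)) 1
    (f := fun x : V ↦ f x + δ x / 2) (ε := fun x : V ↦ δ x / 2) (by fun_prop) (by fun_prop)
    (fun x ↦ half_pos (hpos x x.2))
  classical
  refine ⟨fun x ↦ if hx : x ∈ U then g ⟨x, hx⟩ else 0, fun x hx ↦ ⟨?_, ?_⟩⟩
  · have h₁ : ContMDiffAt 𝓘(ℝ, X) 𝓘(ℝ, ℝ) 1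
        (fun y : V ↦ (fun x ↦ if hx : x ∈ U then g ⟨x, hx⟩ else 0) (y : X)) ⟨x, hx⟩ := by
      refine (g.contMDiff ⟨x, hx⟩).congr_of_eventuallyEq (.of_forall fun y ↦ ?_)
      exact dif_pos y.2
    have h₂ := contMDiffAt_subtype_iff (I := 𝓘(ℝ, X)) (I' := 𝓘(ℝ, ℝ)) (U := V) (n := 1)
      (f := fun x ↦ if hx : x ∈ U then g ⟨x, hx⟩ else 0) (x := ⟨x, hx⟩)
    exact (h₂.1 h₁).contDiffAt.differentiableAt one_ne_zero
  · have := hg ⟨x, hx⟩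
    rw [Real.dist_eq, abs_lt] at this
    simp only [dif_pos hx]
    constructor <;> linarith

/-- The convex envelope of `F`: the lower boundary of the convex hull of its epigraph. -/
def convexEnvelope {X : Type*} [AddCommGroup X] [Module ℝ X] (F : X → ℝ) (x : X) : ℝ :=
  sInf {t | (x, t) ∈ convexHull ℝ {p : X × ℝ | F p.1 ≤ p.2}}

section Envelope

variable {X : Type*} [AddCommGroup X] [Module ℝ X] {F h : X → ℝ}

theorem le_of_mem_convexHull_epigraph (hconv : ConvexOn ℝ univ h) (hF : ∀ x, h x ≤ F x)
    {p : X × ℝ} (hp : p ∈ convexHull ℝ {p : X × ℝ | F p.1 ≤ p.2}) : h p.1 ≤ p.2 := by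
  have hsub : {p : X × ℝ | F p.1 ≤ p.2} ⊆ {p : X × ℝ | p.1 ∈ univ ∧ h p.1 ≤ p.2} :=
    fun q hq ↦ ⟨mem_univ _, (hF q.1).trans hq⟩
  exact (convexHull_min hsub hconv.convex_epigraph hp).2

theorem convexEnvelope_le_of_mem (hconv : ConvexOn ℝ univ h) (hF : ∀ x, h x ≤ F x)
    {x : X} {t : ℝ} (ht : (x, t) ∈ convexHull ℝ {p : X × ℝ | F p.1 ≤ p.2}) :
    convexEnvelope F x ≤ t :=
  csInf_le ⟨h x, fun _ hs ↦ le_of_mem_convexHull_epigraph hconv hF hs⟩ ht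

theorem mem_convexHull_epigraph_self (F : X → ℝ) (x : X) :
    (x, F x) ∈ convexHull ℝ {p : X × ℝ | F p.1 ≤ p.2} :=
  subset_convexHull ℝ _ (le_refl (F x))

theorem convexEnvelope_le (hconv : ConvexOn ℝ univ h) (hF : ∀ x, h x ≤ F x) (x : X) :
    convexEnvelope F x ≤ F x :=
  convexEnvelope_le_of_mem hconv hF (mem_convexHull_epigraph_self F x)

theorem le_convexEnvelope (hconv : ConvexOn ℝ univ h) (hF : ∀ x, h x ≤ F x) (x : X) :
    h x ≤ convexEnvelope F x :=
  le_csInf ⟨F x, mem_convexHull_epigraph_self F x⟩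
    fun _ hs ↦ le_of_mem_convexHull_epigraph hconv hF hs

theorem exists_mem_convexHull_lt_convexEnvelope_add (F : X → ℝ) (x : X) {ε : ℝ} (hε : 0 < ε) :
    ∃ t, (x, t) ∈ convexHull ℝ {p : X × ℝ | F p.1 ≤ p.2} ∧ t < convexEnvelope F x + ε :=
  exists_lt_of_csInf_lt ⟨F x, mem_convexHull_epigraph_self F x⟩ (lt_add_of_pos_right _ hε)

theorem convexOn_convexEnvelope (hconv : ConvexOn ℝ univ h) (hF : ∀ x, h x ≤ F x) :
    ConvexOn ℝ univ (convexEnvelope F) := by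
  refine ⟨convex_univ, fun x _ y _ a b ha hb hab ↦ le_of_forall_pos_le_add fun ε hε ↦ ?_⟩
  obtain ⟨s, hs, hs'⟩ := exists_mem_convexHull_lt_convexEnvelope_add F x hε
  obtain ⟨t, ht, ht'⟩ := exists_mem_convexHull_lt_convexEnvelope_add F y hε
  have := convexEnvelope_le_of_mem hconv hF
    (x := a • x + b • y) (t := a • s + b • t) (convex_convexHull ℝ _ hs ht ha hb hab)
  simp only [smul_eq_mul] at this ⊢
  have h₁ := mul_le_mul_of_nonneg_left hs'.le ha
  have h₂ := mul_le_mul_of_nonneg_left ht'.le hb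
  have h₃ : a * ε + b * ε = ε := by rw [← add_mul, hab, one_mul]
  linarith

/-- By Carathéodory's theorem, the convex envelope is controlled by moving a single point whose
weight is bounded below. -/
theorem exists_weight_point_of_mem_convexHull [FiniteDimensional ℝ X] {m : ℝ}
    (hm : ∀ x, m ≤ F x)
    {x : X} {t : ℝ} (ht : (x, t) ∈ convexHull ℝ {p : X × ℝ | F p.1 ≤ p.2}) :
    ∃ (w : ℝ) (y : X), 1 / ((Module.finrank ℝ (X × ℝ) : ℝ) + 1) ≤ w ∧ w ≤ 1 ∧
      w * (F y - m) ≤ t - m ∧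
      ∀ z, (x + w • (z - y), t + w * (F z - F y)) ∈ convexHull ℝ {p : X × ℝ | F p.1 ≤ p.2} := by
  classical
  obtain ⟨ι, _, z, w, hz, hind, hw, hsum, heq⟩ := eq_pos_convex_span_of_mem_convexHull ht
  have hz' : ∀ i, F (z i).1 ≤ (z i).2 := fun i ↦ hz (mem_range_self i)
  have hcard : (Fintype.card ι : ℝ) ≤ (Module.finrank ℝ (X × ℝ) : ℝ) + 1 := by
    have := hind.card_le_finrank_succ.trans (Nat.succ_le_succ (Submodule.finrank_le _))
    exact_mod_cast this
  set N : ℝ := (Module.finrank ℝ (X × ℝ) : ℝ) + 1 with hN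
  have hNpos : 0 < N := by positivity
  obtain ⟨i, -, hi⟩ : ∃ i ∈ Finset.univ, 1 / N ≤ w i := by
    refine Finset.exists_le_of_sum_le ?_ ?_
    · by_contra hne
      rw [Finset.not_nonempty_iff_eq_empty] at hne
      simp [hne] at hsum
    · rw [hsum, Finset.sum_const, nsmul_eq_mul, Finset.card_univ, mul_one_div]
      exact div_le_one_of_le₀ hcard hNpos.le
  have hxsum : ∑ j, w j • (z j).1 = x := by
    simpa [Prod.fst_sum] using congrArg Prod.fst heq
  have htsum : ∑ j, w j * (z j).2 = t := by
    simpa [Prod.snd_sum] using congrArg Prod.snd heq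
  have hbound : w i * ((z i).2 - m) ≤ t - m := by
    have h₁ : t - m = ∑ j, w j * ((z j).2 - m) := by
      simp only [mul_sub, Finset.sum_sub_distrib, htsum, ← Finset.sum_mul, hsum, one_mul]
    rw [h₁]
    exact Finset.single_le_sum (f := fun j ↦ w j * ((z j).2 - m))
      (fun j _ ↦ mul_nonneg (hw j).le (by linarith [hm (z j).1, hz' j])) (Finset.mem_univ i)
  refine ⟨w i, (z i).1, hi, ?_, ?_, fun q ↦ ?_⟩
  · rw [← hsum]
    exact Finset.single_le_sum (fun j _ ↦ (hw j).le) (Finset.mem_univ i)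
  · exact le_trans (mul_le_mul_of_nonneg_left (by linarith [hz' i]) (hw i).le) hbound
  · have hmem : ∑ j, w j • (z j + if j = i then (q - (z i).1, F q - F (z i).1) else 0) ∈
        convexHull ℝ {p : X × ℝ | F p.1 ≤ p.2} := by
      refine (convex_convexHull ℝ _).sum_mem (fun j _ ↦ (hw j).le) hsum fun j _ ↦ ?_
      apply subset_convexHull
      by_cases hj : j = i
      · subst hj
        have := hz' j
        simp only [if_true, mem_ofPred_eq, Prod.fst_add, Prod.snd_add, add_sub_cancel]
        linarith
      · simpa [hj] using hz' j
    convert hmem using 1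
    simp [smul_add, Finset.sum_add_distrib, heq, smul_ite]

end Envelope

/-- The convex envelope of a coercive differentiable function bounded below by a convex function
is differentiable. -/
theorem differentiable_convexEnvelope {X : Type*} [NormedAddCommGroup X] [NormedSpace ℝ X]
    [FiniteDimensional ℝ X] {F h : X → ℝ} (hconv : ConvexOn ℝ univ h) (hF : ∀ x, h x ≤ F x)
    (hcoer : Tendsto F (cocompact X) atTop) (hd : Differentiable ℝ F) :
    Differentiable ℝ (convexEnvelope F) := by
  intro x
  have : ProperSpace X := FiniteDimensional.proper ℝ X
  obtain ⟨x₀, hx₀⟩ := hd.continuous.exists_forall_le hcoer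
  set m := F x₀
  set N : ℝ := (Module.finrank ℝ (X × ℝ) : ℝ) + 1 with hN
  have hNpos : 0 < N := by positivity
  have hstep (k : ℕ) : ∃ p : ℝ × X, p.1 ∈ Icc (1 / N) 1 ∧
      F p.2 ≤ m + N * (convexEnvelope F x + 1 - m) ∧
      ∀ v, convexEnvelope F (x + v) ≤
        convexEnvelope F x + 1 / ((k : ℝ) + 1) + p.1 * (F (p.2 + p.1⁻¹ • v) - F p.2) := by
    have hk : (0 : ℝ) < 1 / ((k : ℝ) + 1) := by positivity
    obtain ⟨t, ht, ht'⟩ := exists_mem_convexHull_lt_convexEnvelope_add F x hk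
    obtain ⟨w, y, hw, hw', hy, hmove⟩ := exists_weight_point_of_mem_convexHull hx₀ ht
    have hwpos : 0 < w := lt_of_lt_of_le (by positivity) hw
    refine ⟨(w, y), ⟨hw, hw'⟩, ?_, fun v ↦ ?_⟩
    · have h₁ : 1 / N * (F y - m) ≤ w * (F y - m) :=
        mul_le_mul_of_nonneg_right hw (by linarith [hx₀ y])
      have h₂ : 1 / ((k : ℝ) + 1) ≤ 1 := by
        rw [div_le_one (by positivity)]
        linarith [k.cast_nonneg (α := ℝ)]
      have h₃ : 1 / N * (F y - m) ≤ convexEnvelope F x + 1 - m := by linarith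
      rw [one_div, inv_mul_le_iff₀ hNpos] at h₃
      dsimp only
      linarith
    · have := convexEnvelope_le_of_mem hconv hF (hmove (y + w⁻¹ • v))
      rw [add_sub_cancel_left, smul_inv_smul₀ hwpos.ne'] at this
      dsimp only
      linarith
  choose p hpIcc hpF hp using hstep
  obtain ⟨K, hK, hKsub⟩ := mem_cocompact.1
    (hcoer.eventually (eventually_gt_atTop (m + N * (convexEnvelope F x + 1 - m))))
  have hpK (k : ℕ) : p k ∈ Icc (1 / N) 1 ×ˢ K := by
    refine ⟨hpIcc k, by_contra fun hmem ↦ ?_⟩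
    exact absurd (hpF k) (not_le.2 (hKsub hmem))
  obtain ⟨⟨w, y⟩, ⟨hw, -⟩, φ, hφ, hlim⟩ := (isCompact_Icc.prod hK).tendsto_subseq hpK
  have hwpos : 0 < w := lt_of_lt_of_le (by positivity) hw.1
  have hupper (v : X) :
      convexEnvelope F (x + v) ≤ convexEnvelope F x + w * (F (y + w⁻¹ • v) - F y) := by
    have hw_lim : Tendsto (fun k ↦ (p (φ k)).1) atTop (𝓝 w) :=
      (continuous_fst.tendsto _).comp hlim
    have hy_lim : Tendsto (fun k ↦ (p (φ k)).2) atTop (𝓝 y) :=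
      (continuous_snd.tendsto _).comp hlim
    have hk_lim : Tendsto (fun k ↦ 1 / ((φ k : ℝ) + 1)) atTop (𝓝 0) :=
      tendsto_one_div_add_atTop_nhds_zero_nat.comp hφ.tendsto_atTop
    have hFv := (hd.continuous.tendsto _).comp
      (hy_lim.add ((hw_lim.inv₀ hwpos.ne').smul_const v))
    have hFy := (hd.continuous.tendsto _).comp hy_lim
    have := (hk_lim.const_add (convexEnvelope F x)).add (hw_lim.mul (hFv.sub hFy))
    rw [add_zero] at this
    exact ge_of_tendsto' this fun k ↦ hp (φ k) v
  have hg : DifferentiableAt ℝ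
      (fun z ↦ convexEnvelope F x + w * (F (y + w⁻¹ • (z - x)) - F y)) x := by
    fun_prop
  refine ((convexOn_convexEnvelope hconv hF).hasFDerivAt_of_le hg.hasFDerivAt
    (fun z ↦ ?_) ?_).differentiableAt
  · simpa using hupper (z - x)
  · simp

/-- Off a closed set there is a positive continuous function which is at most the squared distance
to every point of that set. -/
theorem IsClosed.exists_continuous_pos_le_norm_sub_sq {X : Type*} [NormedAddCommGroup X]
    {A : Set X} (hA : IsClosed A) :
    ∃ δ : X → ℝ, Continuous δ ∧ (∀ x ∈ Aᶜ, 0 < δ x) ∧ ∀ a ∈ A, ∀ x, δ x ≤ ‖x - a‖ ^ 2 := by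
  rcases A.eq_empty_or_nonempty with rfl | hne
  · exact ⟨fun _ ↦ 1, continuous_const, fun _ _ ↦ one_pos, fun _ ha ↦ ha.elim⟩
  · refine ⟨fun x ↦ Metric.infDist x A ^ 2, (Metric.continuous_infDist_pt A).pow 2,
      fun x hx ↦ pow_pos ((hA.notMem_iff_infDist_pos hne).1 hx) 2, fun a ha x ↦ ?_⟩
    rw [← dist_eq_norm]
    exact pow_le_pow_left₀ Metric.infDist_nonneg (Metric.infDist_le_dist_of_mem ha) 2

/-- A continuous function which is differentiable on a closed set `A` has a differentiable majorant
that agrees with it on `A` together with its derivative. -/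
theorem exists_differentiable_majorant_eqOn {X : Type*} [NormedAddCommGroup X]
    [InnerProductSpace ℝ X] [FiniteDimensional ℝ X] {A : Set X} (hA : IsClosed A) {h : X → ℝ}
    (hcont : Continuous h) (hdiff : ∀ x ∈ A, DifferentiableAt ℝ h x) :
    ∃ F : X → ℝ, Differentiable ℝ F ∧ (∀ x, h x ≤ F x) ∧ (∀ x ∈ A, F x = h x) ∧
      ∀ a ∈ A, HasFDerivAt F (fderiv ℝ h a) a := by
  classical
  obtain ⟨δ, hδ, hpos, hle⟩ := hA.exists_continuous_pos_le_norm_sub_sq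
  obtain ⟨u, hu⟩ := hcont.exists_differentiableAt_le_le_add hδ hA.isOpen_compl hpos
  let F : X → ℝ := A.piecewise h u
  have hFA : ∀ x ∈ A, F x = h x := fun x hx ↦ piecewise_eq_of_mem _ _ _ hx
  have hFU : ∀ x ∈ Aᶜ, F x = u x := fun x hx ↦ piecewise_eq_of_notMem _ _ _ hx
  have hge (x : X) : h x ≤ F x := by
    by_cases hx : x ∈ A
    · exact (hFA x hx).ge
    · exact (hu x hx).2.1.trans (hFU x hx).ge
  have hderiv : ∀ a ∈ A, HasFDerivAt F (fderiv ℝ h a) a := by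
    intro a ha
    have hsq : HasFDerivAt (fun x ↦ ‖x - a‖ ^ 2) (0 : X →L[ℝ] ℝ) a := by
      have := ((hasFDerivAt_id (𝕜 := ℝ) a).sub_const a).norm_sq
      simpa using this
    have hk := (hdiff a ha).hasFDerivAt.add hsq
    rw [add_zero] at hk
    refine (hdiff a ha).hasFDerivAt.squeeze hk hge (fun x ↦ ?_) (hFA a ha).symm ?_
    · by_cases hx : x ∈ A
      · rw [hFA x hx]
        exact le_add_of_nonneg_right (sq_nonneg ‖x - a‖)
      · rw [hFU x hx]
        exact (hu x hx).2.2.trans (add_le_add_right (hle a ha x) _)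
    · simp [hFA a ha]
  refine ⟨F, fun x ↦ ?_, hge, hFA, hderiv⟩
  by_cases hx : x ∈ A
  · exact (hderiv x hx).differentiableAt
  · refine (hu x hx).1.congr_of_eventuallyEq ?_
    filter_upwards [hA.isOpen_compl.mem_nhds hx] with y hy using hFU y hy

/-- **Lemma 4.7.** If `h : X → ℝ` is convex and coercive on a finite-dimensional Euclidean
space and differentiable at every point of a closed set `A`, then there is a convex,
coercive, `C¹` function `H : X → ℝ` with `H = h` and `∇H = ∇h` on `A`. -/
theorem c1_convex_coercive_extension
    {X : Type*} [NormedAddCommGroup X] [InnerProductSpace ℝ X] [FiniteDimensional ℝ X]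
    (A : Set X) (hA : IsClosed A)
    (h : X → ℝ) (hconv : ConvexOn ℝ Set.univ h)
    (hcoer : Tendsto h (comap norm atTop) atTop)
    (hdiff : ∀ x ∈ A, DifferentiableAt ℝ h x) :
    ∃ H : X → ℝ, ConvexOn ℝ Set.univ H ∧
      Tendsto H (comap norm atTop) atTop ∧
      ContDiff ℝ 1 H ∧
      (∀ x ∈ A, H x = h x) ∧ (∀ x ∈ A, gradient H x = gradient h x) := by
  have hcont : Continuous h := hconv.locallyLipschitz.continuous
  obtain ⟨F, hFd, hF, hFA, hFderiv⟩ := exists_differentiable_majorant_eqOn hA hcont hdiff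
  have : ProperSpace X := FiniteDimensional.proper ℝ X
  have hFcoer : Tendsto F (cocompact X) atTop := by
    rw [← Metric.cobounded_eq_cocompact, ← comap_norm_atTop]
    exact tendsto_atTop_mono hF hcoer
  have hHconv := convexOn_convexEnvelope hconv hF
  have hHA : ∀ x ∈ A, convexEnvelope F x = h x := fun x hx ↦
    le_antisymm ((convexEnvelope_le hconv hF x).trans (hFA x hx).le) (le_convexEnvelope hconv hF x)
  refine ⟨convexEnvelope F, hHconv, tendsto_atTop_mono (le_convexEnvelope hconv hF) hcoer,
    hHconv.contDiff_one (differentiable_convexEnvelope hconv hF hFcoer hFd), hHA, fun x hx ↦ ?_⟩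
  have hderiv := hHconv.hasFDerivAt_of_le (hFderiv x hx) (convexEnvelope_le hconv hF)
    ((hHA x hx).trans (hFA x hx).symm)
  rw [gradient, gradient, hderiv.fderiv]
end
end
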